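/- arXiv:0907.2055 — 6 statements merged into one kernel-verified Lean document; each statement's English description precedes it below -/
import Mathlib

section
/- Let n ≥ 1 and let β : ℝⁿ → ℝ be a convex, superlinear function, and let α be its conjugate. Then β is the conjugate of α: for every h ∈ ℝⁿ, β(h) = sup_{c ∈ ℝⁿ} (⟨c,h⟩ − α(c)). -/
open RealInnerProductSpace

/-- Fenchel biduality: a convex superlinear `β : ℝⁿ → ℝ` is the conjugate of its
conjugate `α`: for every `h`, `β h = sup_c (⟨c,h⟩ - α c)`. -/
theorem stmt_3 (n : ℕ) (hn : 1 ≤ n)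
    (β α : EuclideanSpace ℝ (Fin n) → ℝ)
    (hconv : ConvexOn ℝ Set.univ β)
    (hsuper : ∀ k : ℝ, 0 ≤ k → ∃ C : ℝ, ∀ h, β h ≥ k * ‖h‖ - C)
    (hα : ∀ c, IsLUB (Set.range fun h => ⟪c, h⟫ - β h) (α c))
    (h : EuclideanSpace ℝ (Fin n)) :
    IsLUB (Set.range fun c => ⟪c, h⟫ - α c) (β h) := by
  refine ⟨?_, fun b hb => le_of_forall_lt fun a ha => ?_⟩
  · rintro _ ⟨c, rfl⟩
    have := (hα c).1 ⟨h, rfl⟩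
    dsimp only at this ⊢
    linarith
  · obtain ⟨a₁, ha₁, hlt⟩ := exists_between ha
    obtain ⟨l, d, hle, heq⟩ := hconv.exists_affine_le_of_lt (𝕜 := ℝ) (Set.mem_univ h) hlt
      isClosed_univ hconv.locallyLipschitz.continuous.continuousOn.lowerSemicontinuousOn
    have hl (x) : l x + d ≤ β x := by simpa using hle ⟨x, Set.mem_univ x⟩
    replace heq : l h + d = a₁ := by simpa using heq
    let c := (InnerProductSpace.toDual ℝ _).symm l
    have hc (x) : ⟪c, x⟫ = l x := InnerProductSpace.toDual_symm_apply
    have hαc : α c ≤ -d := (hα c).2 <| by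
      rintro _ ⟨x, rfl⟩
      dsimp only
      linarith [hl x, hc x]
    have hbc := hb ⟨c, rfl⟩
    dsimp only at hbc
    linarith [hc h]
end

section
/- Let n ≥ 1 and let β : ℝⁿ → ℝ be strictly convex, superlinear, and differentiable at every point. Then the Legendre transform h ↦ ∇β(h) (the gradient of β) is a homeomorphism of ℝⁿ onto ℝⁿ: it is a bijection of ℝⁿ onto ℝⁿ, it is continuous, and its inverse is continuous. -/
open RealInnerProductSpace

section Subgradient

open Filter Topology

/-- If the graph of `f` is closed and `f` maps a neighbourhood of every point into a compact set,
then `f` is continuous. -/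
theorem continuous_of_isClosed_graph_of_eventually_mem_isCompact {X Y : Type*}
    [TopologicalSpace X] [TopologicalSpace Y] {f : X → Y}
    (hgraph : IsClosed {z : X × Y | z.2 = f z.1})
    (hf : ∀ x, ∃ K, IsCompact K ∧ ∀ᶠ x' in 𝓝 x, f x' ∈ K) : Continuous f := by
  refine continuous_iff_continuousAt.2 fun x => ?_
  obtain ⟨K, hK, hmem⟩ := hf x
  refine hK.tendsto_nhds_of_unique_mapClusterPt hmem fun y _ hy => ?_
  obtain ⟨U, hU, hUy⟩ := mapClusterPt_iff_ultrafilter.1 hy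
  have hlim : Tendsto (fun x' => (x', f x')) U (𝓝 (x, y)) :=
    (tendsto_id'.2 hU).prodMk_nhds hUy
  exact hgraph.mem_of_tendsto hlim (Eventually.of_forall fun _ => rfl)

variable {E : Type*} [NormedAddCommGroup E] [InnerProductSpace ℝ E] {f : E → ℝ} {p x : E}

/-- `p` is a subgradient of `f` at `x`. -/
def IsSubgradientAt (f : E → ℝ) (p x : E) : Prop :=
  ∀ y, f x + ⟪p, y - x⟫ ≤ f y

theorem isClosed_setOf_isSubgradientAt (hf : Continuous f) :
    IsClosed {z : E × E | IsSubgradientAt f z.2 z.1} := by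
  simp only [IsSubgradientAt, Set.ofPred_forall]
  exact isClosed_iInter fun y => isClosed_le (by fun_prop) continuous_const

theorem IsSubgradientAt.inner_sub_le (h : IsSubgradientAt f p x) (y : E) :
    f x - ⟪p, x⟫ ≤ f y - ⟪p, y⟫ := by
  have := h y
  rw [inner_sub_right] at this
  linarith

theorem StrictConvexOn.eq_of_isSubgradientAt (hf : StrictConvexOn ℝ Set.univ f) {x' : E}
    (h : IsSubgradientAt f p x) (h' : IsSubgradientAt f p x') : x = x' := by
  by_contra hne
  have hlt := hf.2 (Set.mem_univ x) (Set.mem_univ x') hne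
    (one_half_pos (α := ℝ)) (one_half_pos (α := ℝ)) (add_halves 1)
  have h₁ := h.inner_sub_le ((1 / 2 : ℝ) • x + (1 / 2 : ℝ) • x')
  have h₂ := h'.inner_sub_le ((1 / 2 : ℝ) • x + (1 / 2 : ℝ) • x')
  simp only [inner_add_right, inner_smul_right, smul_eq_mul] at hlt h₁ h₂
  linarith

theorem ConvexOn.isSubgradientAt_of_hasGradientAt [CompleteSpace E]
    (hf : ConvexOn ℝ Set.univ f) (h : HasGradientAt f p x) : IsSubgradientAt f p x := by
  intro y
  have hline : HasDerivAt (f ∘ AffineMap.lineMap x y) ⟪p, y - x⟫ (0 : ℝ) := by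
    have hx : HasFDerivAt f (InnerProductSpace.toDual ℝ E p)
        (AffineMap.lineMap x y (0 : ℝ)) := by
      simpa using h.hasFDerivAt
    simpa using hx.comp_hasDerivAt (0 : ℝ) AffineMap.hasDerivAt_lineMap
  have hslope := (hf.comp_affineMap (AffineMap.lineMap x y)).le_slope_of_hasDerivAt
    (Set.mem_univ (0 : ℝ)) (Set.mem_univ (1 : ℝ)) one_pos hline
  simp [slope_def_field] at hslope
  linarith

theorem IsSubgradientAt.gradient_eq [CompleteSpace E] (h : IsSubgradientAt f p x)
    (hf : DifferentiableAt ℝ f x) : gradient f x = p := by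
  have hmin : IsLocalMin (fun y => f y - InnerProductSpace.toDual ℝ E p y) x :=
    Eventually.of_forall fun y => by simpa using h.inner_sub_le y
  have hzero := hmin.hasFDerivAt_eq_zero
    (hf.hasGradientAt.hasFDerivAt.sub (InnerProductSpace.toDual ℝ E p).hasFDerivAt)
  exact (InnerProductSpace.toDual ℝ E).injective (sub_eq_zero.1 hzero)

theorem ConvexOn.isSubgradientAt_iff [CompleteSpace E] (hf : ConvexOn ℝ Set.univ f)
    (hd : DifferentiableAt ℝ f x) : IsSubgradientAt f p x ↔ p = gradient f x :=
  ⟨fun h => (h.gradient_eq hd).symm,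
    fun h => h ▸ hf.isSubgradientAt_of_hasGradientAt hd.hasGradientAt⟩

theorem IsSubgradientAt.norm_le {M : ℝ} (h : IsSubgradientAt f p x)
    (hM : ∀ y, ‖y - x‖ ≤ 1 → |f y| ≤ M) : ‖p‖ ≤ 2 * M := by
  have hx := abs_le.1 (hM x (by simp))
  rcases eq_or_ne p 0 with rfl | hp
  · simp only [norm_zero]; linarith
  have hp' : ‖p‖ ≠ 0 := norm_ne_zero_iff.2 hp
  have hy := abs_le.1 (hM (x + ‖p‖⁻¹ • p) (by simp [norm_smul, hp']))
  have hsub := h (x + ‖p‖⁻¹ • p)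
  have hinner : ⟪p, x + ‖p‖⁻¹ • p - x⟫ = ‖p‖ := by
    rw [add_sub_cancel_left, inner_smul_right, real_inner_self_eq_norm_sq]
    field_simp
  linarith

theorem exists_isSubgradientAt [ProperSpace E] (hf : Continuous f)
    (hsuper : ∀ k : ℝ, 0 ≤ k → ∃ C : ℝ, ∀ h, f h ≥ k * ‖h‖ - C) (p : E) :
    ∃ x, IsSubgradientAt f p x := by
  obtain ⟨C, hC⟩ := hsuper (‖p‖ + 1) (by positivity)
  have hlim : Tendsto (fun y => f y - ⟪p, y⟫) (cocompact E) atTop := by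
    refine tendsto_atTop_mono (fun y => ?_)
      (tendsto_atTop_add_const_right _ (-C) (tendsto_norm_cocompact_atTop (E := E)))
    linarith [hC y, real_inner_le_norm p y]
  obtain ⟨x, hx⟩ := Continuous.exists_forall_le (by fun_prop) hlim
  refine ⟨x, fun y => ?_⟩
  rw [inner_sub_right]
  linarith [hx y]

theorem continuous_gradient_of_convexOn [ProperSpace E] (hf : ConvexOn ℝ Set.univ f)
    (hd : Differentiable ℝ f) : Continuous (gradient f) := by
  refine continuous_of_isClosed_graph_of_eventually_mem_isCompact ?_ fun x => ?_
  · simpa only [hf.isSubgradientAt_iff (hd _)] using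
      isClosed_setOf_isSubgradientAt hd.continuous
  · obtain ⟨M, hM⟩ := (isCompact_closedBall x 2).exists_bound_of_continuousOn
      hd.continuous.continuousOn
    refine ⟨_, isCompact_closedBall 0 (2 * M), ?_⟩
    filter_upwards [Metric.closedBall_mem_nhds x one_pos] with x' hx'
    rw [mem_closedBall_zero_iff]
    refine ((hf.isSubgradientAt_iff (hd x')).2 rfl).norm_le fun y hy => hM y ?_
    rw [← dist_eq_norm] at hy
    rw [Metric.mem_closedBall] at hx' ⊢
    linarith [dist_triangle y x' x]

/-- A right inverse of the gradient of a strictly convex superlinear function is continuous. -/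
theorem continuous_of_rightInverse_gradient [ProperSpace E] (hf : StrictConvexOn ℝ Set.univ f)
    (hsuper : ∀ k : ℝ, 0 ≤ k → ∃ C : ℝ, ∀ h, f h ≥ k * ‖h‖ - C)
    (hd : Differentiable ℝ f) {g : E → E} (hg : Function.RightInverse g (gradient f)) :
    Continuous g := by
  have hsub (p : E) : IsSubgradientAt f p (g p) :=
    (hf.convexOn.isSubgradientAt_iff (hd _)).2 (hg p).symm
  refine continuous_of_isClosed_graph_of_eventually_mem_isCompact ?_ fun p => ?_
  · have hgraph : {z : E × E | z.2 = g z.1} = Prod.swap ⁻¹' {z | IsSubgradientAt f z.2 z.1} := by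
      ext ⟨p, x⟩
      exact ⟨fun h => (show x = g p from h) ▸ hsub p, fun h => hf.eq_of_isSubgradientAt h (hsub p)⟩
    rw [hgraph]
    exact (isClosed_setOf_isSubgradientAt hd.continuous).preimage continuous_swap
  · obtain ⟨C, hC⟩ := hsuper (‖p‖ + 2) (by positivity)
    refine ⟨_, isCompact_closedBall 0 (f 0 + C), ?_⟩
    filter_upwards [Metric.closedBall_mem_nhds p one_pos] with q hq
    have hq' : ‖q‖ ≤ ‖p‖ + 1 := by
      rw [mem_closedBall_iff_norm] at hq
      linarith [norm_le_norm_add_norm_sub' q p]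
    have hmin := (hsub q).inner_sub_le 0
    rw [inner_zero_right] at hmin
    rw [mem_closedBall_zero_iff]
    linarith [hC (g q), real_inner_le_norm q (g q),
      mul_le_mul_of_nonneg_right hq' (norm_nonneg (g q))]

end Subgradient

/-- For a strictly convex, superlinear, everywhere differentiable `β : ℝⁿ → ℝ`, the
Legendre transform `h ↦ ∇β(h)` is a homeomorphism of `ℝⁿ` onto itself. -/
theorem stmt_6 (n : ℕ) (hn : 1 ≤ n)
    (β : EuclideanSpace ℝ (Fin n) → ℝ)
    (hconv : StrictConvexOn ℝ Set.univ β)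
    (hsuper : ∀ k : ℝ, 0 ≤ k → ∃ C : ℝ, ∀ h, β h ≥ k * ‖h‖ - C)
    (hdiff : Differentiable ℝ β) :
    Function.Bijective (fun h => gradient β h) ∧
    Continuous (fun h => gradient β h) ∧
    Continuous (Function.invFun (fun h => gradient β h)) := by
  have hsub (x p : EuclideanSpace ℝ (Fin n)) : IsSubgradientAt β p x ↔ p = gradient β x :=
    hconv.convexOn.isSubgradientAt_iff (hdiff x)
  have hsurj : Function.Surjective (gradient β) := fun p =>
    (exists_isSubgradientAt hdiff.continuous hsuper p).imp fun x hx => ((hsub x p).1 hx).symm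
  refine ⟨⟨fun x x' h => ?_, hsurj⟩, continuous_gradient_of_convexOn hconv.convexOn hdiff,
    continuous_of_rightInverse_gradient hconv hsuper hdiff (Function.rightInverse_invFun hsurj)⟩
  exact hconv.eq_of_isSubgradientAt ((hsub x _).2 rfl) ((hsub x' _).2 h)
end

section
/- Let d ≥ 1 and let h₁, …, hₙ be finitely many vectors in ℝ^d. Let S ⊆ ℝ^d be a set contained in the union of the n lines ℝ·h₁ ∪ … ∪ ℝ·hₙ through the origin, and let K be the convex hull of S. Then the set of extreme points of K is finite and has cardinality at most 2n (at most two extreme points on each of the lines ℝ·h₁, …, ℝ·hₙ). -/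
/-- An extreme point weakly between two points of the set is one of them. -/
theorem eq_or_eq_of_wbtw_of_mem_extremePoints {E : Type*} [AddCommGroup E] [Module ℝ E]
    {A : Set E} {x y z : E} (hx : x ∈ A) (hy : y ∈ A.extremePoints ℝ) (hz : z ∈ A)
    (h : Wbtw ℝ x y z) : x = y ∨ z = y :=
  (mem_extremePoints_iff_forall_segment.1 hy).2 x hx z hz (mem_segment_iff_wbtw.2 h)

/-- A set has at most two extreme points on any line. -/
theorem Collinear.encard_le_two_of_subset_extremePoints {E : Type*} [AddCommGroup E]
    [Module ℝ E] {A s : Set E} (hs : Collinear ℝ s) (hsA : s ⊆ A.extremePoints ℝ) :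
    s.encard ≤ 2 := by
  by_contra! hlt
  obtain ⟨t, hts, ht⟩ := Set.exists_subset_encard_eq
    (k := 2 + 1) (s := s) (Order.add_one_le_of_lt hlt)
  obtain ⟨x, y, z, hxy, hxz, hyz, rfl⟩ :=
    Set.encard_eq_three.1 (ht.trans two_add_one_eq_three)
  have hx := hsA (hts (show x ∈ ({x, y, z} : Set E) by simp))
  have hy := hsA (hts (show y ∈ ({x, y, z} : Set E) by simp))
  have hz := hsA (hts (show z ∈ ({x, y, z} : Set E) by simp))
  rcases (hs.subset hts).wbtw_or_wbtw_or_wbtw with h | h | h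
  · have := eq_or_eq_of_wbtw_of_mem_extremePoints hx.1 hy hz.1 h
    tauto
  · have := eq_or_eq_of_wbtw_of_mem_extremePoints hy.1 hz hx.1 h
    tauto
  · have := eq_or_eq_of_wbtw_of_mem_extremePoints hz.1 hx hy.1 h
    tauto

/-- If `S ⊆ ℝ^d` is contained in a union of `n` lines through the origin, then the
convex hull of `S` has at most `2n` extreme points. -/
theorem stmt_8 (d n : ℕ) (hd : 1 ≤ d)
    (h : Fin n → EuclideanSpace ℝ (Fin d))
    (S : Set (EuclideanSpace ℝ (Fin d)))
    (hS : S ⊆ ⋃ i : Fin n, {x : EuclideanSpace ℝ (Fin d) | ∃ t : ℝ, x = t • h i})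
    (K : Set (EuclideanSpace ℝ (Fin d))) (hK : K = convexHull ℝ S) :
    (Set.extremePoints ℝ K).Finite ∧ (Set.extremePoints ℝ K).ncard ≤ 2 * n := by
  subst hK
  set P := Set.extremePoints ℝ (convexHull ℝ S)
  let L : Fin n → Set (EuclideanSpace ℝ (Fin d)) := fun i => {x | ∃ t : ℝ, x = t • h i}
  have hL (i : Fin n) : (P ∩ L i).encard ≤ 2 := by
    refine Collinear.encard_le_two_of_subset_extremePoints ?_ Set.inter_subset_left
    refine (collinear_iff_exists_forall_eq_smul_vadd _).2 ⟨0, h i, ?_⟩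
    rintro x ⟨-, t, rfl⟩
    exact ⟨t, by simp⟩
  have hP : P = ⋃ i, P ∩ L i := by
    rw [← Set.inter_iUnion]
    exact (Set.inter_eq_left.2 (extremePoints_convexHull_subset.trans hS)).symm
  have hcard : P.encard ≤ (2 * n : ℕ) := by
    calc P.encard = (⋃ i, P ∩ L i).encard := congrArg _ hP
      _ ≤ ∑ i, (P ∩ L i).encard := Set.encard_iUnion_le_of_fintype _
      _ ≤ ∑ _i : Fin n, 2 := Finset.sum_le_sum fun i _ => hL i
      _ = (2 * n : ℕ) := by simp [mul_comm]
  exact Set.encard_le_coe_iff_finite_ncard_le.1 hcard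
end

section
/- Let n ≥ 1, let K ⊆ ℝⁿ be a compact convex set, and let ℓ : ℝⁿ → ℝ be a continuous linear functional with ℓ(h) > 0 for every h ∈ K. Define Ψ(h) := (ℓ(h))⁻¹ · h for h ∈ K. If x is an extreme point of the convex set Ψ(K), then there exists h ∈ K such that Ψ(h) = x and h is an extreme point of K. -/
/-- The part of `K` lying over an extreme point of the radial projection of `K` onto the
hyperplane `ℓ = 1` is an extreme subset of `K`. -/
theorem isExtreme_radialProjection_fiber {E : Type*} [AddCommGroup E] [Module ℝ E]
    {K : Set E} {ℓ : E →ₗ[ℝ] ℝ} (hpos : ∀ h ∈ K, 0 < ℓ h) {x : E}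
    (hx : x ∈ Set.extremePoints ℝ ((fun h => (ℓ h)⁻¹ • h) '' K)) :
    IsExtreme ℝ K (K ∩ {h | h = ℓ h • x}) where
  subset := Set.inter_subset_left
  left_mem_of_mem_openSegment := by
    rintro u hu v hv z ⟨hz, hzx⟩ ⟨a, b, ha, hb, -, hab⟩
    refine ⟨hu, ?_⟩
    have hu0 := hpos u hu
    have hv0 := hpos v hv
    have hz0 := hpos z hz
    have hℓ : ℓ z = a * ℓ u + b * ℓ v := by simp [← hab]
    have hux : (ℓ u)⁻¹ • u = x := by
      refine hx.2 (Set.mem_image_of_mem _ hu) (Set.mem_image_of_mem _ hv)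
        ⟨a * ℓ u / ℓ z, b * ℓ v / ℓ z, by positivity, by positivity, ?_, ?_⟩
      · rw [← add_div, ← hℓ, div_self hz0.ne']
      · have hxz : x = (ℓ z)⁻¹ • z := (inv_smul_eq_iff₀ hz0.ne').2 hzx |>.symm
        rw [hxz]
        nth_rewrite 4 [← hab]
        simp only [smul_add, smul_smul]
        congr 2 <;> field_simp
    exact (inv_smul_eq_iff₀ hu0.ne').1 hux

/-- Extreme points of the radial projection of a compact convex set `K ⊆ ℝⁿ` come
from extreme points of `K`. -/
theorem stmt_10 (n : ℕ) (hn : 1 ≤ n)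
    (K : Set (EuclideanSpace ℝ (Fin n))) (hKc : IsCompact K) (hK : Convex ℝ K)
    (ℓ : EuclideanSpace ℝ (Fin n) →L[ℝ] ℝ)
    (hpos : ∀ h ∈ K, 0 < ℓ h)
    (Ψ : EuclideanSpace ℝ (Fin n) → EuclideanSpace ℝ (Fin n))
    (hΨ : ∀ h, Ψ h = (ℓ h)⁻¹ • h)
    (x : EuclideanSpace ℝ (Fin n))
    (hx : x ∈ Set.extremePoints ℝ (Ψ '' K)) :
    ∃ h ∈ K, Ψ h = x ∧ h ∈ Set.extremePoints ℝ K := by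
  obtain rfl : Ψ = fun h => (ℓ h)⁻¹ • h := funext hΨ
  have hcompact : IsCompact (K ∩ {h | h = ℓ h • x}) :=
    hKc.inter_right (isClosed_eq continuous_id (by fun_prop))
  have hne : (K ∩ {h | h = ℓ h • x}).Nonempty := by
    obtain ⟨h, hh, hhx⟩ := hx.1
    exact ⟨h, hh, (inv_smul_eq_iff₀ (hpos h hh).ne').1 hhx⟩
  obtain ⟨h, hh⟩ := hcompact.extremePoints_nonempty hne
  have hext := isExtreme_radialProjection_fiber (ℓ := ℓ.toLinearMap) hpos hx
  exact ⟨h, hh.1.1, (inv_smul_eq_iff₀ (hpos h hh.1.1).ne').2 hh.1.2,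
    hext.extremePoints_subset_extremePoints hh⟩
end

section
/- There is no continuous bijection from ℝ to ℝ²: if f : ℝ → ℝ × ℝ is continuous, then f is not bijective. -/
/-- A continuous map from the plane to the line is not injective. -/
lemma not_injective_of_continuous_real_prod {h : ℝ × ℝ → ℝ} (hc : Continuous h) :
    ¬ Function.Injective h := by
  intro hi
  have rank_gt : 1 < Module.rank ℝ (ℝ × ℝ) := by
    rw [rank_prod', Module.rank_self, one_add_one_eq_two]
    exact Cardinal.one_lt_two
  have hne : h (0, 0) ≠ h (1, 0) := fun e => by simpa using hi e
  have mid_mem : (h (0, 0) + h (1, 0)) / 2 ∈ Set.uIcc (h (0, 0)) (h (1, 0)) := by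
    rw [Set.mem_uIcc]
    rcases le_total (h (0, 0)) (h (1, 0)) with hl | hl
    · left; constructor <;> linarith
    · right; constructor <;> linarith
  obtain ⟨x, hx⟩ : (h (0, 0) + h (1, 0)) / 2 ∈ Set.range h :=
    (isPreconnected_range hc).ordConnected.uIcc_subset
      (Set.mem_range_self _) (Set.mem_range_self _) mid_mem
  have hpre : IsPreconnected (h '' {x}ᶜ) :=
    (isConnected_compl_singleton_of_one_lt_rank rank_gt x).isPreconnected.image h
      hc.continuousOn
  have h0 : (0, 0) ≠ x := by
    rintro rfl
    exact hne (by linarith)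
  have h1 : (1, 0) ≠ x := by
    rintro rfl
    exact hne (by linarith)
  obtain ⟨y, hy, hyx⟩ := hpre.ordConnected.uIcc_subset
    (Set.mem_image_of_mem h h0) (Set.mem_image_of_mem h h1) mid_mem
  exact hy (hi (hyx.trans hx.symm))

/-- The image of a compact set of reals under a continuous injective map to the plane has
empty interior. -/
lemma interior_image_eq_empty_of_injective {f : ℝ → ℝ × ℝ} (hf : Continuous f)
    (hi : Function.Injective f) {K : Set ℝ} (hK : IsCompact K) : interior (f '' K) = ∅ := by
  by_contra hne
  obtain ⟨p, hp⟩ := Set.nonempty_iff_ne_empty.mpr hne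
  obtain ⟨r, hr, hball⟩ := Metric.isOpen_iff.mp isOpen_interior p hp
  have : CompactSpace K := isCompact_iff_compactSpace.mp hK
  have hemb : Topology.IsClosedEmbedding (fun x : K => f x) :=
    (hf.comp continuous_subtype_val).isClosedEmbedding (hi.comp Subtype.val_injective)
  let u := OpenPartialHomeomorph.univBall p r
  have hu : ∀ y, ∃ x : K, f x = u y := by
    intro y
    have hy : u y ∈ Metric.ball p r := by
      rw [← OpenPartialHomeomorph.univBall_target p hr]
      exact u.map_source (by simp [u])
    obtain ⟨x, hx, hxy⟩ := interior_subset (hball hy)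
    exact ⟨⟨x, hx⟩, hxy⟩
  choose g hg using hu
  have hgc : Continuous g := by
    rw [hemb.isEmbedding.continuous_iff]
    exact (OpenPartialHomeomorph.continuous_univBall p r).congr fun y => (hg y).symm
  refine not_injective_of_continuous_real_prod (continuous_subtype_val.comp hgc) ?_
  intro a b hab
  refine u.injOn (by simp [u]) (by simp [u]) ?_
  rw [← hg a, ← hg b]
  exact congrArg f hab

/-- There is no continuous bijection from `ℝ` to `ℝ²`. -/
theorem stmt_11 (f : ℝ → ℝ × ℝ) (hf : Continuous f) : ¬ Function.Bijective f := by
  rintro ⟨hi, hs⟩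
  have hK : ∀ n : ℕ, IsCompact (Metric.closedBall (0 : ℝ) n) :=
    fun n => isCompact_closedBall 0 n
  obtain ⟨n, hn⟩ := nonempty_interior_of_iUnion_of_closed
    (f := fun n : ℕ => f '' Metric.closedBall (0 : ℝ) n)
    (fun n => ((hK n).image hf).isClosed)
    (by rw [← Set.image_iUnion, Metric.iUnion_closedBall_nat, Set.image_univ, hs.range_eq])
  simp [interior_image_eq_empty_of_injective hf hi (hK n)] at hn
end

section
/- Let X be a Hausdorff topological space and let φ : ℝ × X → X be a continuous flow, i.e. φ is jointly continuous, φ(0,x) = x for all x, and φ(s+t,x) = φ(s, φ(t,x)) for all s,t ∈ ℝ and x ∈ X. Suppose xₙ → x in X, and for each n, Tₙ > 0 satisfies φ(Tₙ, xₙ) = xₙ. Suppose x is periodic with minimal period T > 0, i.e. φ(T,x) = x and φ(t,x) ≠ x for all t with 0 < t < T. Then liminf Tₙ ≥ T; equivalently, for every T' < T, one has Tₙ > T' for all sufficiently large n. -/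
/-- Every natural multiple of a period of a point of a flow is again a period. -/
theorem flow_nat_mul_period {X : Type*} (φ : ℝ × X → X)
    (h0 : ∀ x : X, φ (0, x) = x)
    (hadd : ∀ (s t : ℝ) (x : X), φ (s + t, x) = φ (s, φ (t, x)))
    {y : X} {τ : ℝ} (hτ : φ (τ, y) = y) (k : ℕ) : φ (k * τ, y) = y := by
  induction k with
  | zero => simpa using h0 y
  | succ k ih =>
    rw [Nat.cast_succ, add_one_mul, hadd, hτ, ih]

/-- A positive real `τ ≤ b` has a natural multiple in `[a, b]` as soon as `0 < a` and
`2 * a ≤ b`. -/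
theorem exists_nat_mul_mem_Icc {a b τ : ℝ} (ha : 0 < a) (hab : 2 * a ≤ b) (hτ : 0 < τ)
    (hτb : τ ≤ b) : ∃ k : ℕ, (k * τ : ℝ) ∈ Set.Icc a b := by
  rcases le_or_gt a τ with h | h
  · exact ⟨1, by simpa using ⟨h, hτb⟩⟩
  · refine ⟨⌈a / τ⌉₊, (div_le_iff₀ hτ).1 (Nat.le_ceil _), ?_⟩
    have hlt := mul_lt_mul_of_pos_right (Nat.ceil_lt_add_one (div_pos ha hτ).le) hτ
    rw [add_one_mul, div_mul_cancel₀ _ hτ.ne'] at hlt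
    linarith


/-- Lower semicontinuity of the minimal period: if `xₙ → x₀`, each `xₙ` is periodic
with period `Tₙ > 0`, and `x₀` has minimal period `Tmin > 0`, then for every
`T' < Tmin` one has `Tₙ > T'` for all large `n` (i.e. `liminf Tₙ ≥ Tmin`). -/
theorem stmt_13 (X : Type*) [TopologicalSpace X] [T2Space X]
    (φ : ℝ × X → X) (hcont : Continuous φ)
    (h0 : ∀ x : X, φ (0, x) = x)
    (hadd : ∀ (s t : ℝ) (x : X), φ (s + t, x) = φ (s, φ (t, x)))
    (x : ℕ → X) (x₀ : X)
    (hx : Filter.Tendsto x Filter.atTop (nhds x₀))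
    (T : ℕ → ℝ) (hTpos : ∀ n, 0 < T n) (hTper : ∀ n, φ (T n, x n) = x n)
    (Tmin : ℝ) (hTminpos : 0 < Tmin) (hper : φ (Tmin, x₀) = x₀)
    (hmin : ∀ t : ℝ, 0 < t → t < Tmin → φ (t, x₀) ≠ x₀)
    (T' : ℝ) (hT' : T' < Tmin) :
    ∃ N : ℕ, ∀ n ≥ N, T' < T n := by
  have hev : ∀ᶠ y in nhds x₀, ∀ s ∈ Set.Icc (Tmin / 4) (max T' (Tmin / 2)), φ (s, y) ≠ y := by
    refine isCompact_Icc.eventually_forall_of_forall_eventually fun s hs => ?_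
    have hopen : IsOpen {p : X × ℝ | φ (p.2, p.1) ≠ p.1} :=
      isOpen_ne_fun (hcont.comp continuous_swap) continuous_fst
    exact hopen.mem_nhds (hmin s (by linarith [hs.1])
      (hs.2.trans_lt (max_lt hT' (by linarith))))
  obtain ⟨N, hN⟩ := Filter.eventually_atTop.1 (hx.eventually hev)
  refine ⟨N, fun n hn => ?_⟩
  by_contra! hle
  obtain ⟨k, hk⟩ := exists_nat_mul_mem_Icc (a := Tmin / 4) (b := max T' (Tmin / 2))
    (by linarith) (by linarith [le_max_right T' (Tmin / 2)]) (hTpos n)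
    (hle.trans (le_max_left _ _))
  exact hN n hn _ hk (flow_nat_mul_period φ h0 hadd (hTper n) k)
end
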